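/- For every oracle A ⊆ ℕ the following are equivalent: (i) A computes a trace tracing every total computable function (equivalently, A is high); (ii) A computes a partial trace tracing every total computable function. -/

import Mathlib

open Filter

namespace CichonAnalog

/-! ### Oracle computability -/

/-- Partial functions `ℕ →. ℕ` partial recursive relative to the oracle `A ⊆ ℕ`.
This is Mathlib's `Nat.Partrec` with an extra base case for the characteristic
function of the oracle. -/
inductive RecursiveIn (A : Set ℕ) : (ℕ →. ℕ) → Prop
  | zero : RecursiveIn A (pure 0)
  | succ : RecursiveIn A ↑Nat.succ
  | left : RecursiveIn A ↑fun n : ℕ => n.unpair.1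
  | right : RecursiveIn A ↑fun n : ℕ => n.unpair.2
  | oracle : RecursiveIn A ↑fun n : ℕ => A.indicator (fun _ => 1) n
  | pair {f g} : RecursiveIn A f → RecursiveIn A g →
      RecursiveIn A fun n => Nat.pair <$> f n <*> g n
  | comp {f g} : RecursiveIn A f → RecursiveIn A g →
      RecursiveIn A fun n => g n >>= f
  | prec {f g} : RecursiveIn A f → RecursiveIn A g →
      RecursiveIn A (Nat.unpaired fun a n =>
        n.rec (f a) fun y IH => do let i ← IH; g (Nat.pair a (Nat.pair y i)))
  | rfind {f} : RecursiveIn A f →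
      RecursiveIn A fun a => Nat.rfind fun n => (fun m => m = 0) <$> f (Nat.pair a n)

/-- The partial function `f` (between coded spaces) is partial recursive in the oracle `A`. -/
def PartrecIn (A : Set ℕ) {α σ : Type} [Primcodable α] [Primcodable σ] (f : α →. σ) : Prop :=
  RecursiveIn A fun n =>
    Part.bind ↑(Encodable.decode (α := α) n) fun a => (f a).map Encodable.encode

/-- `f ≤_T A` : the (total) function `f` is computable from the oracle `A`. -/
def ComputableIn (A : Set ℕ) {α σ : Type} [Primcodable α] [Primcodable σ] (f : α → σ) : Prop :=
  PartrecIn A (f : α →. σ)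

/-- `W` is computably enumerable in the oracle `A`. -/
def CEIn (A : Set ℕ) {α : Type} [Primcodable α] (W : Set α) : Prop :=
  ∃ f : α →. ℕ, PartrecIn A f ∧ ∀ a, a ∈ W ↔ (f a).Dom

/-- `W` is computably enumerable (unrelativized). -/
def CE {α : Type} [Primcodable α] (W : Set α) : Prop :=
  ∃ f : α →. ℕ, Partrec f ∧ ∀ a, a ∈ W ↔ (f a).Dom

/-! ### Cantor space, `Π⁰₁` classes, effective meagerness -/

/-- The basic clopen set (cylinder) of the finite binary string `σ` in Cantor space. -/
def Cyl (σ : List Bool) : Set (ℕ → Bool) :=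
  {x | ∀ i, i < σ.length → x i = σ.getD i false}

/-- `P` is a `Π⁰₁(A)` class: a closed subset of Cantor space whose complement is the
union of basic clopen sets over a set of strings c.e. in `A`. -/
def Pi01In (A : Set ℕ) (P : Set (ℕ → Bool)) : Prop :=
  ∃ W : Set (List Bool), CEIn A W ∧ P = (⋃ σ ∈ W, Cyl σ)ᶜ

/-- `P` is a (plain) `Π⁰₁` class. -/
def Pi01 (P : Set (ℕ → Bool)) : Prop :=
  ∃ W : Set (List Bool), CE W ∧ P = (⋃ σ ∈ W, Cyl σ)ᶜ

/-- `C` is a uniformly `Π⁰₁(A)` sequence of classes. -/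
def UnifPi01In (A : Set ℕ) (C : ℕ → Set (ℕ → Bool)) : Prop :=
  ∃ W : Set (ℕ × List Bool), CEIn A W ∧
    ∀ m, C m = (⋃ σ ∈ {s | (m, s) ∈ W}, Cyl σ)ᶜ

/-- `C` is a uniformly `Π⁰₁` sequence of classes. -/
def UnifPi01 (C : ℕ → Set (ℕ → Bool)) : Prop :=
  ∃ W : Set (ℕ × List Bool), CE W ∧
    ∀ m, C m = (⋃ σ ∈ {s | (m, s) ∈ W}, Cyl σ)ᶜ

/-- `S` is effectively meager relative to `A`: it is contained in the union of a
uniformly `Π⁰₁(A)` sequence of nowhere dense classes. -/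
def EffMeagerIn (A : Set ℕ) (S : Set (ℕ → Bool)) : Prop :=
  ∃ C : ℕ → Set (ℕ → Bool), UnifPi01In A C ∧ (∀ m, IsNowhereDense (C m)) ∧ S ⊆ ⋃ m, C m

/-- `S` is effectively meager (unrelativized). -/
def EffMeager (S : Set (ℕ → Bool)) : Prop :=
  ∃ C : ℕ → Set (ℕ → Bool), UnifPi01 C ∧ (∀ m, IsNowhereDense (C m)) ∧ S ⊆ ⋃ m, C m

/-- `A` is meager engulfing: some `A`-effectively meager set contains every
effectively meager set. -/
def MeagerEngulfing (A : Set ℕ) : Prop :=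
  ∃ S, EffMeagerIn A S ∧ ∀ T, EffMeager T → T ⊆ S

/-- `A` is weakly meager engulfing: some `A`-effectively meager set contains every
computable element of Cantor space. -/
def WeaklyMeagerEngulfing (A : Set ℕ) : Prop :=
  ∃ S, EffMeagerIn A S ∧ ∀ x : ℕ → Bool, Computable x → x ∈ S

/-- `V` is a computable set of finite binary strings. -/
def ComputableStringSet (V : Set (List Bool)) : Prop :=
  ∃ χ : List Bool → Bool, Computable χ ∧ ∀ s, s ∈ V ↔ χ s = true

/-- `V` is a dense set of finite binary strings: every string has an extension in `V`. -/
def DenseStringSet (V : Set (List Bool)) : Prop :=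
  ∀ σ : List Bool, ∃ τ ∈ V, σ <+: τ

/-- `x ∈ 2^ω` is weakly 1-generic: for every computable dense set `V` of finite
binary strings, some initial segment of `x` lies in `V`. -/
def Weakly1Generic (x : ℕ → Bool) : Prop :=
  ∀ V : Set (List Bool), ComputableStringSet V → DenseStringSet V →
    ∃ n, (List.ofFn fun i : Fin n => x i) ∈ V

/-! ### Domination properties -/

/-- `A` is high: `A` computes a function dominating every total computable function. -/
def High (A : Set ℕ) : Prop :=
  ∃ f : ℕ → ℕ, ComputableIn A f ∧
    ∀ g : ℕ → ℕ, Computable g → ∀ᶠ n in atTop, g n ≤ f n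

/-- `A` is of hyperimmune degree: `A` computes a function not dominated by any
computable function. -/
def HyperimmuneDegree (A : Set ℕ) : Prop :=
  ∃ f : ℕ → ℕ, ComputableIn A f ∧
    ∀ g : ℕ → ℕ, Computable g → ∃ᶠ n in atTop, g n < f n

/-- `A` is of hyperimmune-free degree: every function computable in `A` is dominated
by a total computable function. -/
def HyperimmuneFree (A : Set ℕ) : Prop :=
  ∀ f : ℕ → ℕ, ComputableIn A f →
    ∃ g : ℕ → ℕ, Computable g ∧ ∀ᶠ n in atTop, f n ≤ g n

/-! ### Measure on Cantor space, Kurtz and Schnorr tests -/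

open scoped Classical in
/-- The uniform measure of the clopen set `⋃ σ ∈ F, [σ]` determined by the finite
list `F` of binary strings: count the binary strings of maximal length extending
some member of `F`, and normalize. -/
noncomputable def listMeasure (F : List (List Bool)) : ℚ :=
  letI k := (F.map List.length).foldr max 0
  ((Finset.univ.filter fun v : Fin k → Bool =>
      ∃ σ ∈ F, σ <+: List.ofFn v).card : ℚ) / 2 ^ k

/-- The clopen subset of Cantor space given explicitly as a finite union of
basic clopen sets. -/
def ClopSet (F : List (List Bool)) : Set (ℕ → Bool) := ⋃ σ ∈ F, Cyl σ

/-- The effectively open subset of Cantor space enumerated by the sequence of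
finite stages `g`. -/
def OpenSet (g : ℕ → List (List Bool)) : Set (ℕ → Bool) := ⋃ s, ClopSet (g s)

/-- The measure of the open set enumerated by the stages `g`: the supremum of the
measures of its finite partial unions. -/
noncomputable def openMeasure (g : ℕ → List (List Bool)) : ℝ :=
  ⨆ s : ℕ, (listMeasure ((List.range (s + 1)).flatMap g) : ℝ)

/-- A Kurtz test relative to `A`: an `A`-computable sequence of explicitly given
clopen sets, the `m`-th of measure at most `2 ^ (-m)`. -/
def KurtzTestIn (A : Set ℕ) (G : ℕ → List (List Bool)) : Prop :=
  ComputableIn A G ∧ ∀ m, listMeasure (G m) ≤ (1 / 2) ^ m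

/-- A (plain) Kurtz test. -/
def KurtzTest (G : ℕ → List (List Bool)) : Prop :=
  Computable G ∧ ∀ m, listMeasure (G m) ≤ (1 / 2) ^ m

/-- A Schnorr test relative to `A`: an `A`-computable doubly indexed sequence of finite
stages such that the `m`-th effectively open set `⋃ s, ClopSet (g m s)` has measure at
most `2 ^ (-m)`, and this measure is a real computable in `A` uniformly in `m`. -/
def SchnorrTestIn (A : Set ℕ) (g : ℕ → ℕ → List (List Bool)) : Prop :=
  ComputableIn A (fun p : ℕ × ℕ => g p.1 p.2) ∧
  (∀ m, openMeasure (g m) ≤ (1 / 2) ^ m) ∧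
  ∃ q : ℕ × ℕ → ℚ, ComputableIn A q ∧
    ∀ m k, |openMeasure (g m) - (q (m, k) : ℝ)| ≤ (1 / 2) ^ k

/-- A (plain) Schnorr test. -/
def SchnorrTest (g : ℕ → ℕ → List (List Bool)) : Prop :=
  Computable (fun p : ℕ × ℕ => g p.1 p.2) ∧
  (∀ m, openMeasure (g m) ≤ (1 / 2) ^ m) ∧
  ∃ q : ℕ × ℕ → ℚ, Computable q ∧
    ∀ m k, |openMeasure (g m) - (q (m, k) : ℝ)| ≤ (1 / 2) ^ k

/-- `N` is Schnorr null relative to `A`. -/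
def SchnorrNullIn (A : Set ℕ) (N : Set (ℕ → Bool)) : Prop :=
  ∃ g, SchnorrTestIn A g ∧ N ⊆ ⋂ m, OpenSet (g m)

/-- `N` is Schnorr null (unrelativized). -/
def SchnorrNull (N : Set (ℕ → Bool)) : Prop :=
  ∃ g, SchnorrTest g ∧ N ⊆ ⋂ m, OpenSet (g m)

/-- `x ∈ 2^ω` is Schnorr random: it belongs to no Schnorr null set. -/
def SchnorrRandom (x : ℕ → Bool) : Prop := ∀ N, SchnorrNull N → x ∉ N

/-- `A` is Kurtz engulfing: there is an `A`-computable sequence of Kurtz tests relative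
to `A` such that every Kurtz null set is contained in the null set of one of them. -/
def KurtzEngulfing (A : Set ℕ) : Prop :=
  ∃ G : ℕ → ℕ → List (List Bool),
    ComputableIn A (fun p : ℕ × ℕ => G p.1 p.2) ∧
    (∀ i m, listMeasure (G i m) ≤ (1 / 2) ^ m) ∧
    ∀ L, KurtzTest L → ∃ i, (⋂ m, ClopSet (L m)) ⊆ ⋂ m, ClopSet (G i m)

/-- `A` is weakly Kurtz engulfing: there is an `A`-computable sequence of Kurtz tests
relative to `A` such that the union of their null sets contains every computable
element of Cantor space. -/
def WeaklyKurtzEngulfing (A : Set ℕ) : Prop :=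
  ∃ G : ℕ → ℕ → List (List Bool),
    ComputableIn A (fun p : ℕ × ℕ => G p.1 p.2) ∧
    (∀ i m, listMeasure (G i m) ≤ (1 / 2) ^ m) ∧
    ∀ x : ℕ → Bool, Computable x → ∃ i, x ∈ ⋂ m, ClopSet (G i m)

/-- `A` is weakly Schnorr engulfing: some set Schnorr null relative to `A` contains
every computable element of Cantor space. -/
def WeaklySchnorrEngulfing (A : Set ℕ) : Prop :=
  ∃ N, SchnorrNullIn A N ∧ ∀ x : ℕ → Bool, Computable x → x ∈ N

/-! ### DNR and PA degrees -/

/-- The `e`-th partial computable function. -/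
noncomputable def phi (e : ℕ) : ℕ →. ℕ := (Denumerable.ofNat Nat.Partrec.Code e).eval

/-- `h` is diagonally nonrecursive. -/
def DNRFun (h : ℕ → ℕ) : Prop := ∀ e, ∀ y ∈ phi e e, h e ≠ y

/-- `A` is DNR: `A` computes a diagonally nonrecursive function. -/
def DNRDegree (A : Set ℕ) : Prop := ∃ h : ℕ → ℕ, ComputableIn A h ∧ DNRFun h

/-- `A` is PA: `A` computes a `{0,1}`-valued diagonally nonrecursive function. -/
def PA (A : Set ℕ) : Prop :=
  ∃ h : ℕ → ℕ, ComputableIn A h ∧ (∀ e, h e ≤ 1) ∧ DNRFun h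

/-! ### Traces -/

/-- The trace `σ` (satisfying `|σ n| ≤ n`) traces the function `f` if
`f n ∈ σ n` for all but finitely many `n`. -/
def Traces (σ : ℕ → Finset ℕ) (f : ℕ → ℕ) : Prop := ∀ᶠ n in atTop, f n ∈ σ n

/-- `σ` is a `(D, g)`-trace relative to `A`: `D` is infinite and c.e. in `A`, `g` is a
partial `A`-computable function with `D ⊆ dom g` and `g n ≥ n` on its domain, and `σ`
is partial `A`-computable, defined on `D`, with `|σ n| < g n` for all `n ∈ D`. -/
def IsDGTraceIn (A : Set ℕ) (D : Set ℕ) (g : ℕ →. ℕ) (σ : ℕ →. Finset ℕ) : Prop :=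
  D.Infinite ∧ CEIn A D ∧ PartrecIn A g ∧ D ⊆ g.Dom ∧ (∀ n, ∀ y ∈ g n, n ≤ y) ∧
  PartrecIn A σ ∧ D ⊆ σ.Dom ∧ ∀ n ∈ D, ∀ S ∈ σ n, ∀ b ∈ g n, S.card < b

/-- `σ` is a `(D, g)`-trace (unrelativized). -/
def IsDGTrace (D : Set ℕ) (g : ℕ →. ℕ) (σ : ℕ →. Finset ℕ) : Prop :=
  D.Infinite ∧ CE D ∧ Partrec g ∧ D ⊆ g.Dom ∧ (∀ n, ∀ y ∈ g n, n ≤ y) ∧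
  Partrec σ ∧ D ⊆ σ.Dom ∧ ∀ n ∈ D, ∀ S ∈ σ n, ∀ b ∈ g n, S.card < b

/-- The `(D, g)`-trace `σ` traces `f`: `f n ∈ σ n` for all but finitely many `n ∈ D`. -/
def DGTraces (D : Set ℕ) (σ : ℕ →. Finset ℕ) (f : ℕ → ℕ) : Prop :=
  ∀ᶠ n in atTop, n ∈ D → ∀ S ∈ σ n, f n ∈ S

/-! ### Basic closure properties of oracle computability -/

theorem RecursiveIn.of_eq {A : Set ℕ} {f g : ℕ →. ℕ} (hf : RecursiveIn A f)
    (h : ∀ n, f n = g n) : RecursiveIn A g :=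
  (funext h : f = g) ▸ hf

theorem recursiveIn_indicator (A : Set ℕ) :
    RecursiveIn A ((fun n => A.indicator (fun _ => 1) n : ℕ → ℕ) : ℕ →. ℕ) :=
  RecursiveIn.oracle.of_eq fun n => by
    by_cases h : n ∈ A <;> simp [h] <;> rfl

theorem RecursiveIn.of_partrec {A : Set ℕ} {f : ℕ →. ℕ} (hf : Nat.Partrec f) :
    RecursiveIn A f := by
  induction hf with
  | zero => exact .zero
  | succ => exact .succ
  | left => exact .left
  | right => exact .right
  | pair _ _ ihf ihg => exact .pair ihf ihg
  | comp _ _ ihf ihg => exact .comp ihf ihg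
  | prec _ _ ihf ihg => exact .prec ihf ihg
  | rfind _ ihf => exact .rfind ihf

theorem RecursiveIn.of_computable {A : Set ℕ} {f : ℕ → ℕ} (hf : Computable f) :
    RecursiveIn A (f : ℕ →. ℕ) :=
  .of_partrec (Partrec.nat_iff.1 hf)

theorem RecursiveIn.comp_total {A : Set ℕ} {f g : ℕ → ℕ} (hf : RecursiveIn A (f : ℕ →. ℕ))
    (hg : RecursiveIn A (g : ℕ →. ℕ)) : RecursiveIn A ((fun n => f (g n) : ℕ → ℕ) : ℕ →. ℕ) :=
  (RecursiveIn.comp hf hg).of_eq fun _ => Part.bind_some _ _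

theorem RecursiveIn.comp_computable₂ {A : Set ℕ} {F : ℕ → ℕ → ℕ} {f g : ℕ → ℕ}
    (hF : Computable₂ F) (hf : RecursiveIn A (f : ℕ →. ℕ)) (hg : RecursiveIn A (g : ℕ →. ℕ)) :
    RecursiveIn A ((fun n => F (f n) (g n) : ℕ → ℕ) : ℕ →. ℕ) := by
  have hF' : Computable fun n : ℕ => F n.unpair.1 n.unpair.2 :=
    hF.comp (Computable.fst.comp Computable.unpair) (Computable.snd.comp Computable.unpair)
  refine (RecursiveIn.comp (.of_computable hF') (.pair hf hg)).of_eq fun n => ?_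
  have hpair : (Nat.pair <$> Part.some (f n) <*> Part.some (g n)) =
      Part.some (Nat.pair (f n) (g n)) := by simp [Seq.seq]
  exact (congrArg (Part.bind · _) hpair).trans ((Part.bind_some _ _).trans (by simp))

theorem ComputableIn.recursiveIn_encode {A : Set ℕ} {α : Type} [Primcodable α] {f : ℕ → α}
    (hf : ComputableIn A f) :
    RecursiveIn A ((fun n => Encodable.encode (f n) : ℕ → ℕ) : ℕ →. ℕ) :=
  RecursiveIn.of_eq hf fun n => by simp

theorem PartrecIn.recursiveIn_encode {A : Set ℕ} {α : Type} [Primcodable α] {f : ℕ →. α}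
    (hf : PartrecIn A f) : RecursiveIn A fun n => (f n).map Encodable.encode :=
  RecursiveIn.of_eq hf fun n => by simp

theorem ComputableIn.of_recursiveIn_encode {A : Set ℕ} {α : Type} [Primcodable α] {f : ℕ → α}
    (hf : RecursiveIn A ((fun n => Encodable.encode (f n) : ℕ → ℕ) : ℕ →. ℕ)) :
    ComputableIn A f :=
  RecursiveIn.of_eq hf fun n => by simp

theorem PartrecIn.of_partrec {A : Set ℕ} {α β : Type} [Primcodable α] [Primcodable β]
    {f : α →. β} (hf : Partrec f) : PartrecIn A f :=
  RecursiveIn.of_partrec hf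

/-! ### Finite approximations of oracle computations -/

/-- The first `s` values of the characteristic function of the oracle `A`. -/
noncomputable def oraclePrefix (A : Set ℕ) (s : ℕ) : List ℕ :=
  (List.range s).map fun n => A.indicator (fun _ => 1) n

@[simp]
theorem length_oraclePrefix (A : Set ℕ) (s : ℕ) : (oraclePrefix A s).length = s := by
  simp [oraclePrefix]

theorem recursiveIn_oraclePrefix (A : Set ℕ) :
    RecursiveIn A ((fun s => Encodable.encode (oraclePrefix A s) : ℕ → ℕ) : ℕ →. ℕ) := by
  have hF : Computable₂ fun i x : ℕ =>
      Encodable.encode (Denumerable.ofNat (List ℕ) i ++ [x]) := by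
    refine (Primrec.encode.comp (Primrec.list_append.comp
      ((Primrec.ofNat (List ℕ)).comp Primrec.fst)
      (Primrec.list_cons.comp Primrec.snd (Primrec.const [])))).to_comp.to₂
  have h2 : Computable fun z : ℕ => z.unpair.2 := Computable.snd.comp Computable.unpair
  have h1 : Computable fun z : ℕ => z.unpair.1 := Computable.fst.comp Computable.unpair
  have hstep := RecursiveIn.comp_computable₂ (A := A) hF
    (.of_computable (h2.comp h2))
    (RecursiveIn.comp_total (recursiveIn_indicator A) (.of_computable (h1.comp h2)))
  have hprec := RecursiveIn.prec
    (.of_computable (Computable.const (Encodable.encode ([] : List ℕ)))) hstep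
  have hpair : Computable fun s : ℕ => Nat.pair 0 s :=
    (Primrec₂.natPair.comp (Primrec.const 0) Primrec.id).to_comp
  refine (RecursiveIn.comp hprec (.of_computable hpair)).of_eq fun s => ?_
  induction s with
  | zero => simp [oraclePrefix]
  | succ s ih =>
    simp only [PFun.coe_val, Part.bind_eq_bind, Part.bind_some, Nat.unpaired,
      Nat.unpair_pair] at ih ⊢
    rw [ih]
    simp [oraclePrefix, List.range_succ]

/-- The stagewise approximation `G`, reading only finitely much of the oracle,
converges to the partial function `f`. -/
structure Approximates (A : Set ℕ) (G : List ℕ → ℕ → Option ℕ) (f : ℕ → Part ℕ) : Prop where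
  primrec : Primrec₂ G
  mono : ∀ {s t n y}, s ≤ t → y ∈ G (oraclePrefix A s) n → y ∈ G (oraclePrefix A t) n
  mem_iff : ∀ {n y}, y ∈ f n ↔ ∃ s, y ∈ G (oraclePrefix A s) n

theorem Approximates.of_primrec (A : Set ℕ) {f : ℕ → ℕ} (hf : Primrec f) :
    Approximates A (fun _ n => some (f n)) (fun n => Part.some (f n)) where
  primrec := (Primrec.option_some.comp (hf.comp Primrec.snd)).to₂
  mono _ h := h
  mem_iff := by simp [eq_comm]

theorem Approximates.oracle (A : Set ℕ) :
    Approximates A (fun l n => l[n]?) (fun n => Part.some (A.indicator (fun _ => 1) n)) where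
  primrec := Primrec.list_getElem?
  mono {s t n y} hst h := by
    simp [oraclePrefix, List.getElem?_eq_some_iff] at h ⊢
    exact ⟨by omega, h.2⟩
  mem_iff {n y} := by
    simp [oraclePrefix, List.getElem?_eq_some_iff]
    exact ⟨fun h => ⟨⟨n + 1, by omega⟩, h.symm⟩, fun h => h.2.symm⟩

theorem Approximates.pair {A : Set ℕ} {F G : List ℕ → ℕ → Option ℕ} {f g : ℕ → Part ℕ}
    (hf : Approximates A F f) (hg : Approximates A G g) :
    Approximates A (fun l n => (F l n).bind fun x => (G l n).map fun y => Nat.pair x y)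
      (fun n => Nat.pair <$> f n <*> g n) where
  primrec := by
    refine Primrec.option_bind hf.primrec
      (g := fun p x => (G p.1 p.2).map fun y => Nat.pair x y) ?_
    exact (Primrec.option_map (f := fun q : (List ℕ × ℕ) × ℕ => G q.1.1 q.1.2)
      (g := fun q y => Nat.pair q.2 y)
      (hg.primrec.comp (Primrec.fst.comp Primrec.fst) (Primrec.snd.comp Primrec.fst))
      (Primrec₂.natPair.comp (Primrec.snd.comp Primrec.fst) Primrec.snd)).to₂
  mono {s t n y} hst h := by
    simp only [Option.mem_def, Option.bind_eq_some_iff, Option.map_eq_some_iff] at h ⊢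
    obtain ⟨a, ha, b, hb, rfl⟩ := h
    exact ⟨a, hf.mono hst ha, b, hg.mono hst hb, rfl⟩
  mem_iff {n y} := by
    simp only [Seq.seq, Part.map_eq_map, Part.bind_map, Part.mem_bind_iff, Part.mem_map_iff,
      hf.mem_iff, hg.mem_iff, Option.mem_def, Option.bind_eq_some_iff, Option.map_eq_some_iff]
    constructor
    · rintro ⟨a, ⟨s, ha⟩, b, ⟨t, hb⟩, rfl⟩
      exact ⟨max s t, a, hf.mono (le_max_left _ _) ha, b, hg.mono (le_max_right _ _) hb, rfl⟩
    · rintro ⟨s, a, ha, b, hb, rfl⟩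
      exact ⟨a, ⟨s, ha⟩, b, ⟨s, hb⟩, rfl⟩

theorem Approximates.comp {A : Set ℕ} {F G : List ℕ → ℕ → Option ℕ} {f g : ℕ → Part ℕ}
    (hf : Approximates A F f) (hg : Approximates A G g) :
    Approximates A (fun l n => (G l n).bind (F l)) (fun n => g n >>= f) where
  primrec := Primrec.option_bind hg.primrec
    (hf.primrec.comp (Primrec.fst.comp Primrec.fst) Primrec.snd).to₂
  mono {s t n y} hst h := by
    simp only [Option.mem_def, Option.bind_eq_some_iff] at h ⊢
    obtain ⟨a, ha, hy⟩ := h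
    exact ⟨a, hg.mono hst ha, hf.mono hst hy⟩
  mem_iff {n y} := by
    simp only [Part.bind_eq_bind, Part.mem_bind_iff, hf.mem_iff, hg.mem_iff, Option.mem_def,
      Option.bind_eq_some_iff]
    constructor
    · rintro ⟨a, ⟨s, ha⟩, t, hy⟩
      exact ⟨max s t, a, hg.mono (le_max_left _ _) ha, hf.mono (le_max_right _ _) hy⟩
    · rintro ⟨s, a, ha, hy⟩
      exact ⟨a, ⟨s, ha⟩, s, hy⟩

theorem Approximates.mono_natRec {A : Set ℕ} {F G : List ℕ → ℕ → Option ℕ} {f g : ℕ → Part ℕ}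
    (hf : Approximates A F f) (hg : Approximates A G g) {s t a k y : ℕ} (hst : s ≤ t)
    (h : y ∈ (Nat.rec (F (oraclePrefix A s) a) (fun y IH => IH.bind fun i =>
      G (oraclePrefix A s) (Nat.pair a (Nat.pair y i))) k : Option ℕ)) :
    y ∈ (Nat.rec (F (oraclePrefix A t) a) (fun y IH => IH.bind fun i =>
      G (oraclePrefix A t) (Nat.pair a (Nat.pair y i))) k : Option ℕ) := by
  induction k generalizing y with
  | zero => exact hf.mono hst h
  | succ k ih =>
    simp only [Option.mem_def, Option.bind_eq_some_iff] at h ih ⊢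
    obtain ⟨i, hi, hy⟩ := h
    exact ⟨i, ih hi, hg.mono hst hy⟩

theorem Approximates.prec {A : Set ℕ} {F G : List ℕ → ℕ → Option ℕ} {f g : ℕ → Part ℕ}
    (hf : Approximates A F f) (hg : Approximates A G g) :
    Approximates A
      (fun l z => Nat.rec (F l z.unpair.1)
        (fun y IH => IH.bind fun i => G l (Nat.pair z.unpair.1 (Nat.pair y i))) z.unpair.2)
      (Nat.unpaired fun a n =>
        n.rec (f a) fun y IH => do let i ← IH; g (Nat.pair a (Nat.pair y i))) where
  primrec := by
    have hz : Primrec fun p : List ℕ × ℕ => p.2.unpair := Primrec.unpair.comp Primrec.snd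
    refine Primrec.nat_rec' (Primrec.snd.comp hz)
      (hf.primrec.comp Primrec.fst (Primrec.fst.comp hz))
      (h := fun p q => q.2.bind fun i => G p.1 (Nat.pair p.2.unpair.1 (Nat.pair q.1 i))) ?_
    refine Primrec.option_bind (Primrec.snd.comp Primrec.snd) (Primrec₂.comp hg.primrec
      (Primrec.fst.comp (Primrec.fst.comp Primrec.fst)) (Primrec₂.natPair.comp
        (Primrec.fst.comp (hz.comp (Primrec.fst.comp Primrec.fst)))
        (Primrec₂.natPair.comp (Primrec.fst.comp (Primrec.snd.comp Primrec.fst)) Primrec.snd)))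
  mono hst h := hf.mono_natRec hg hst h
  mem_iff {z} y := by
    simp only [Nat.unpaired]
    induction z.unpair.2 generalizing y with
    | zero => exact hf.mem_iff
    | succ k ih =>
      simp only [Part.bind_eq_bind, Option.mem_def] at ih
      simp only [Part.bind_eq_bind, Part.mem_bind_iff, ih, hg.mem_iff, Option.mem_def,
        Option.bind_eq_some_iff]
      constructor
      · rintro ⟨a, ⟨s, ha⟩, t, hy⟩
        exact ⟨max s t, a, hf.mono_natRec hg (le_max_left _ _) ha,
          hg.mono (le_max_right _ _) hy⟩
      · rintro ⟨s, a, ha, hy⟩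
        exact ⟨a, ⟨s, ha⟩, s, hy⟩

/-- Bounded search: look for a zero of `F l (Nat.pair a ·)` below `l.length`,
giving up at the first argument where `F` is undefined. -/
def boundedFind (F : List ℕ → ℕ → Option ℕ) (l : List ℕ) (a : ℕ) : Option ℕ :=
  let n := (List.range l.length).findIdx fun n => (F l (Nat.pair a n)).getD 0 == 0
  if F l (Nat.pair a n) = some 0 then some n else none

theorem primrec_boundedFind {F : List ℕ → ℕ → Option ℕ} (hF : Primrec₂ F) :
    Primrec₂ (boundedFind F) := by
  have hn : Primrec fun p : List ℕ × ℕ => (List.range p.1.length).findIdx fun n =>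
      (F p.1 (Nat.pair p.2 n)).getD 0 == 0 := by
    refine Primrec.list_findIdx (Primrec.list_range.comp (Primrec.list_length.comp Primrec.fst)) ?_
    refine (Primrec.beq.comp (Primrec.option_getD.comp (Primrec₂.comp hF
      (Primrec.fst.comp Primrec.fst) (Primrec₂.natPair.comp (Primrec.snd.comp Primrec.fst)
        Primrec.snd)) (Primrec.const 0)) (Primrec.const 0)).to₂
  exact Primrec.ite (Primrec.eq.comp (hF.comp Primrec.fst
    (Primrec₂.natPair.comp Primrec.snd hn)) (Primrec.const (some 0)))
    (Primrec.option_some.comp hn) (Primrec.const none)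

theorem mem_boundedFind {F : List ℕ → ℕ → Option ℕ} {l : List ℕ} {a y : ℕ} :
    y ∈ boundedFind F l a ↔ 0 ∈ F l (Nat.pair a y) ∧ y ≤ l.length ∧
      ∀ m < y, ∃ v ∈ F l (Nat.pair a m), v ≠ 0 := by
  have key : ∀ {v : Option ℕ}, (v.getD 0 == 0) = false ↔ ∃ w ∈ v, w ≠ 0 := by
    intro v; cases v <;> simp
  have hlen : ((List.range l.length).findIdx fun n => (F l (Nat.pair a n)).getD 0 == 0)
      ≤ l.length := by
    simpa using List.findIdx_le_length (xs := List.range l.length)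
      (p := fun n => (F l (Nat.pair a n)).getD 0 == 0)
  have hlt : ∀ m < (List.range l.length).findIdx fun n => (F l (Nat.pair a n)).getD 0 == 0,
      ∃ v ∈ F l (Nat.pair a m), v ≠ 0 := by
    intro m hm
    have := List.not_of_lt_findIdx hm
    rw [← key]
    simpa using this
  unfold boundedFind
  constructor
  · intro h
    simp only [Option.mem_def, Option.ite_none_right_eq_some, Option.some.injEq] at h
    obtain ⟨h0, rfl⟩ := h
    exact ⟨h0, hlen, hlt⟩
  · rintro ⟨h0, hy, hm⟩
    have : ((List.range l.length).findIdx fun n => (F l (Nat.pair a n)).getD 0 == 0) = y := by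
      refine le_antisymm ?_ ?_
      · by_contra! hlt'
        obtain ⟨v, hv, hv0⟩ := hlt y hlt'
        exact hv0 (Option.mem_unique hv h0)
      · by_contra! hlt'
        have hlt'' : ((List.range l.length).findIdx fun n =>
            (F l (Nat.pair a n)).getD 0 == 0) < (List.range l.length).length := by
          simpa using hlt'.trans_le hy
        have h1 := List.findIdx_getElem (w := hlt'')
        rw [List.getElem_range] at h1
        have h2 := key.2 (hm _ hlt')
        simp_all
    simp only [this]
    simpa using h0

theorem Approximates.rfind {A : Set ℕ} {F : List ℕ → ℕ → Option ℕ} {f : ℕ → Part ℕ}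
    (hf : Approximates A F f) :
    Approximates A (boundedFind F)
      (fun a => Nat.rfind fun n => (fun m => m = 0) <$> f (Nat.pair a n)) where
  primrec := primrec_boundedFind hf.primrec
  mono {s t n y} hst h := by
    rw [mem_boundedFind] at h ⊢
    simp only [length_oraclePrefix] at h ⊢
    refine ⟨hf.mono hst h.1, h.2.1.trans hst, fun m hm => ?_⟩
    obtain ⟨v, hv, hv0⟩ := h.2.2 m hm
    exact ⟨v, hf.mono hst hv, hv0⟩
  mem_iff {n y} := by
    refine Nat.mem_rfind.trans ?_
    simp only [mem_boundedFind, length_oraclePrefix, Part.map_eq_map,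
      Part.mem_map_iff, decide_eq_true_eq, decide_eq_false_iff_not, exists_eq_right]
    constructor
    · rintro ⟨h0, hm⟩
      have hm' : ∀ m < y, ∃ s, ∃ v ∈ F (oraclePrefix A s) (Nat.pair n m), v ≠ 0 := by
        intro m hlt
        obtain ⟨v, hv, hv0⟩ := hm hlt
        obtain ⟨s, hs⟩ := hf.mem_iff.1 hv
        exact ⟨s, v, hs, hv0⟩
      choose! s hs using hm'
      obtain ⟨s₀, hs₀⟩ := hf.mem_iff.1 h0
      refine ⟨max s₀ (max y ((Finset.range y).sup s)), hf.mono (le_max_left _ _) hs₀,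
        by simp, fun m hlt => ?_⟩
      obtain ⟨v, hv, hv0⟩ := hs m hlt
      refine ⟨v, hf.mono ?_ hv, hv0⟩
      exact le_max_of_le_right (le_max_of_le_right
        (Finset.le_sup (f := s) (Finset.mem_range.2 hlt)))
    · rintro ⟨s, h0, -, hm⟩
      refine ⟨hf.mem_iff.2 ⟨s, h0⟩, fun {m} hlt => ?_⟩
      obtain ⟨v, hv, hv0⟩ := hm m hlt
      exact ⟨v, hf.mem_iff.2 ⟨s, hv⟩, hv0⟩

theorem RecursiveIn.exists_approximates {A : Set ℕ} {f : ℕ →. ℕ} (hf : RecursiveIn A f) :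
    ∃ G, Approximates A G f := by
  induction hf with
  | zero => exact ⟨_, .of_primrec A (Primrec.const 0)⟩
  | succ => exact ⟨_, .of_primrec A Primrec.succ⟩
  | left => exact ⟨_, .of_primrec A (Primrec.fst.comp Primrec.unpair)⟩
  | right => exact ⟨_, .of_primrec A (Primrec.snd.comp Primrec.unpair)⟩
  | oracle =>
    refine ⟨_, cast (congrArg _ (funext fun n => ?_)) (Approximates.oracle A)⟩
    by_cases h : n ∈ A <;> simp [h] <;> rfl
  | pair _ _ ihf ihg =>
    obtain ⟨F, hF⟩ := ihf
    obtain ⟨G, hG⟩ := ihg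
    exact ⟨_, hF.pair hG⟩
  | comp _ _ ihf ihg =>
    obtain ⟨F, hF⟩ := ihf
    obtain ⟨G, hG⟩ := ihg
    exact ⟨_, hF.comp hG⟩
  | prec _ _ ihf ihg =>
    obtain ⟨F, hF⟩ := ihf
    obtain ⟨G, hG⟩ := ihg
    exact ⟨_, hF.prec hG⟩
  | rfind _ ihf =>
    obtain ⟨F, hF⟩ := ihf
    exact ⟨_, hF.rfind⟩

/-- From a partial `A`-recursive function with infinite domain one obtains a total
`A`-recursive function bounding, at each `m`, some value at an argument `d ≥ m`. -/
theorem RecursiveIn.exists_total_bound {A : Set ℕ} {f : ℕ →. ℕ} (hf : RecursiveIn A f)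
    (hinf : f.Dom.Infinite) :
    ∃ h : ℕ → ℕ, RecursiveIn A (h : ℕ →. ℕ) ∧ ∀ m, ∃ d ≥ m, ∃ v ∈ f d, v ≤ h m := by
  obtain ⟨G, hG⟩ := hf.exists_approximates
  let P (m t s : ℕ) : Prop := m ≤ t.unpair.2.unpair.1 ∧
    G (Denumerable.ofNat (List ℕ) s) t.unpair.2.unpair.1 = some t.unpair.2.unpair.2
  let F (z s : ℕ) : ℕ := if P z.unpair.1 z.unpair.2 s then 0 else 1
  have hF : Computable₂ F := by
    have hm : Primrec fun p : ℕ × ℕ => p.1.unpair.1 :=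
      Primrec.fst.comp (Primrec.unpair.comp Primrec.fst)
    have ht : Primrec fun p : ℕ × ℕ => p.1.unpair.2.unpair.2.unpair :=
      Primrec.unpair.comp (Primrec.snd.comp (Primrec.unpair.comp
        (Primrec.snd.comp (Primrec.unpair.comp Primrec.fst))))
    refine (Primrec.ite (PrimrecPred.and (Primrec.nat_le.comp hm (Primrec.fst.comp ht))
      (Primrec.eq.comp (hG.primrec.comp ((Primrec.ofNat (List ℕ)).comp Primrec.snd)
        (Primrec.fst.comp ht)) (Primrec.option_some.comp (Primrec.snd.comp ht))))
      (Primrec.const 0) (Primrec.const 1)).to_comp.to₂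
  have h2 : Computable fun z : ℕ => z.unpair.2 := Computable.snd.comp Computable.unpair
  have h1 : Computable fun z : ℕ => z.unpair.1 := Computable.fst.comp Computable.unpair
  have hsearch := RecursiveIn.rfind (RecursiveIn.comp_computable₂ (A := A) hF
    (.of_computable Computable.id)
    (RecursiveIn.comp_total (recursiveIn_oraclePrefix A) (.of_computable (h1.comp h2))))
  let Q (m t : ℕ) : Prop := P m t (Encodable.encode (oraclePrefix A t.unpair.1))
  have hex : ∀ m, ∃ t, Q m t := by
    intro m
    obtain ⟨d, hd, hmd⟩ := hinf.exists_gt m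
    obtain ⟨v, hv⟩ := Part.dom_iff_mem.1 hd
    obtain ⟨s, hs⟩ := hG.mem_iff.1 hv
    exact ⟨Nat.pair s (Nat.pair d v), by simpa [Q, P] using ⟨hmd.le, hs⟩⟩
  classical
  refine ⟨fun m => Nat.find (hex m), hsearch.of_eq fun m => ?_, fun m => ?_⟩
  · refine Part.eq_some_iff.2 (Nat.mem_rfind.2 ⟨?_, fun {t} ht => ?_⟩)
    · have := Nat.find_spec (hex m)
      simpa [F, Q] using this
    · have := Nat.find_min (hex m) ht
      simpa [F, Q] using this
  · obtain ⟨hmd, hv⟩ : Q m (Nat.find (hex m)) := Nat.find_spec (hex m)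
    rw [Denumerable.ofNat_encode] at hv
    exact ⟨_, hmd, _, hG.mem_iff.2 ⟨_, hv⟩, (Nat.unpair_right_le _).trans (Nat.unpair_right_le _)⟩

/-! ### Codes of finite sets -/

theorem ofNat_finset_eq (c : ℕ) : Denumerable.ofNat (Finset ℕ) c =
    Denumerable.raise'Finset (Denumerable.ofNat (List ℕ) c) 0 := by
  have hid : (Denumerable.eqv ℕ).symm.toEmbedding = Function.Embedding.refl ℕ := by
    ext n
    rfl
  change Finset.map (Denumerable.eqv ℕ).symm.toEmbedding _ = _
  rw [hid, Finset.map_refl]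

theorem le_of_mem_raise' {l : List ℕ} {n x : ℕ} (hx : x ∈ Denumerable.raise' l n) :
    x ≤ n + Encodable.encode l := by
  induction l generalizing n with
  | nil => simp [Denumerable.raise'] at hx
  | cons m l ih =>
    have := Nat.add_le_pair m (Encodable.encode l)
    simp only [Denumerable.raise', List.mem_cons] at hx
    simp only [Encodable.encode_list_cons, Encodable.encode_nat]
    rcases hx with rfl | hx
    · omega
    · have := ih hx
      omega

theorem le_encode_of_mem_finset {s : Finset ℕ} {x : ℕ} (hx : x ∈ s) :
    x ≤ @Encodable.encode (Finset ℕ) Primcodable.toEncodable s := by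
  obtain ⟨c, rfl⟩ : ∃ c, Denumerable.ofNat (Finset ℕ) c = s :=
    ⟨_, Denumerable.ofNat_encode s⟩
  rw [ofNat_finset_eq] at hx
  have := le_of_mem_raise' (l := Denumerable.ofNat (List ℕ) c) hx
  rw [Denumerable.encode_ofNat] at this
  refine this.trans ?_
  simp

theorem foldl_eq_raise' (l acc : List ℕ) (n : ℕ) :
    (l.foldl (fun p m => (p.1 ++ [m + p.2], m + p.2 + 1)) (acc, n)).1 =
      acc ++ Denumerable.raise' l n := by
  induction l generalizing acc n with
  | nil => simp [Denumerable.raise']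
  | cons m l ih => simp [Denumerable.raise', ih]

theorem primrec_raise' : Primrec fun l : List ℕ => Denumerable.raise' l 0 := by
  have hstep : Primrec₂ fun (_ : List ℕ) (q : (List ℕ × ℕ) × ℕ) =>
      (q.1.1 ++ [q.2 + q.1.2], q.2 + q.1.2 + 1) := by
    have hadd : Primrec fun q : List ℕ × ((List ℕ × ℕ) × ℕ) => q.2.2 + q.2.1.2 :=
      Primrec.nat_add.comp (Primrec.snd.comp Primrec.snd)
        (Primrec.snd.comp (Primrec.fst.comp Primrec.snd))
    exact Primrec.pair (Primrec.list_append.comp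
      (Primrec.fst.comp (Primrec.fst.comp Primrec.snd))
      (Primrec.list_cons.comp hadd (Primrec.const []))) (Primrec.succ.comp hadd)
  refine (Primrec.fst.comp (Primrec.list_foldl Primrec.id
    (Primrec.const (([], 0) : List ℕ × ℕ)) hstep)).of_eq fun l => ?_
  simpa using foldl_eq_raise' l [] 0

theorem length_raise' (l : List ℕ) (n : ℕ) : (Denumerable.raise' l n).length = l.length := by
  induction l generalizing n with
  | nil => rfl
  | cons m l ih => simp [Denumerable.raise', ih]

/-- There is a computable function turning a list into a code of a finite set containing
all the members of the list and having at most as many elements as the list is long. -/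
theorem exists_computable_finsetCode : ∃ F : List ℕ → ℕ, Computable F ∧ ∀ l,
    (Denumerable.ofNat (Finset ℕ) (F l)).card ≤ l.length ∧
      ∀ x ∈ l, x ∈ Denumerable.ofNat (Finset ℕ) (F l) := by
  classical
  let P (l : List ℕ) (c : ℕ) : Prop := (Denumerable.ofNat (List ℕ) c).length ≤ l.length ∧
    ∀ x ∈ l, ∃ y ∈ Denumerable.raise' (Denumerable.ofNat (List ℕ) c) 0, y = x
  have hP_iff : ∀ l c, P l c ↔ (Denumerable.ofNat (Finset ℕ) c).card ≤ l.length ∧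
      ∀ x ∈ l, x ∈ Denumerable.ofNat (Finset ℕ) c := by
    intro l c
    rw [ofNat_finset_eq]
    simp only [P, exists_eq_right, ← length_raise' (Denumerable.ofNat (List ℕ) c) 0]
    rfl
  have hP : PrimrecRel P := by
    have hc : Primrec fun p : List ℕ × ℕ => Denumerable.ofNat (List ℕ) p.2 :=
      (Primrec.ofNat _).comp Primrec.snd
    refine PrimrecPred.and (Primrec.nat_le.comp (Primrec.list_length.comp hc)
      (Primrec.list_length.comp Primrec.fst)) ?_
    have hmem : PrimrecRel fun (x : ℕ) (l : List ℕ) => ∃ y ∈ l, y = x :=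
      (PrimrecRel.exists_mem_list (R := fun y x : ℕ => y = x) Primrec.eq).comp
        Primrec.snd Primrec.fst
    exact (PrimrecRel.forall_mem_list hmem).comp Primrec.fst (primrec_raise'.comp hc)
  have hex : ∀ l, ∃ c, P l c := by
    intro l
    refine ⟨@Encodable.encode (Finset ℕ) Primcodable.toEncodable l.toFinset, ?_⟩
    rw [hP_iff, Denumerable.ofNat_encode]
    exact ⟨l.toFinset_card_le, by simp⟩
  refine ⟨fun l => Nat.find (hex l), ?_, fun l => (hP_iff l _).1 (Nat.find_spec (hex l))⟩
  have hsearch : Partrec fun l => Nat.rfind fun c => Part.some (decide (P l c)) :=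
    Partrec.rfind hP.decide.to_comp
  refine hsearch.of_eq_tot fun l => Nat.mem_rfind.2 ⟨?_, fun {c} hc => ?_⟩
  · simpa using Nat.find_spec (hex l)
  · simpa using Nat.find_min (hex l) hc

/-! ### Highness and traces -/

theorem exists_computable_stage {f : ℕ → ℕ} (hf : Computable f) :
    ∃ (e : ℕ) (t : ℕ → ℕ), Computable t ∧ ∀ n k, t n ≤ k →
      f n ∈ (Denumerable.ofNat Nat.Partrec.Code e).evaln k n := by
  obtain ⟨c, hc⟩ := Nat.Partrec.Code.exists_code.1 (Partrec.nat_iff.1 hf)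
  have hmem : ∀ n y, (∃ k, y ∈ c.evaln k n) ↔ y = f n := by
    intro n y
    rw [← Nat.Partrec.Code.evaln_complete, hc]
    simp
  have hex : ∀ n, ∃ k, ((c.evaln k n).isSome : Prop) := by
    intro n
    obtain ⟨k, hk⟩ := (hmem n _).2 rfl
    exact ⟨k, Option.isSome_iff_exists.2 ⟨_, hk⟩⟩
  refine ⟨Encodable.encode c, fun n => Nat.find (hex n), ?_, fun n k hk => ?_⟩
  · have hsearch : Partrec fun n => Nat.rfind fun k => Part.some (c.evaln k n).isSome := by
      refine Partrec.rfind (Primrec.to_comp ?_)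
      exact Primrec.option_isSome.comp (Nat.Partrec.Code.primrec_evaln.comp
        (Primrec.pair (Primrec.pair Primrec.snd (Primrec.const c)) Primrec.fst))
    refine hsearch.of_eq_tot fun n => Nat.mem_rfind.2 ⟨?_, fun {c} hc => ?_⟩
    · simpa using Nat.find_spec (hex n)
    · simpa using Nat.find_min (hex n) hc
  · obtain ⟨y, hy⟩ := Option.isSome_iff_exists.1 (Nat.find_spec (hex n))
    obtain rfl := (hmem n y).1 ⟨_, hy⟩
    rw [Denumerable.ofNat_encode]
    exact Nat.Partrec.Code.evaln_mono hk hy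

theorem High.exists_trace {A : Set ℕ} (hA : High A) :
    ∃ σ : ℕ → Finset ℕ, ComputableIn A σ ∧ (∀ n, (σ n).card ≤ n) ∧
      ∀ f : ℕ → ℕ, Computable f → Traces σ f := by
  obtain ⟨h, hh, hdom⟩ := hA
  obtain ⟨F, hF, hFspec⟩ := exists_computable_finsetCode
  let vals (n k : ℕ) : List ℕ := (List.range n).map fun e =>
    ((Denumerable.ofNat Nat.Partrec.Code e).evaln k n).getD 0
  have hvals : Primrec₂ vals := by
    refine Primrec.list_map (Primrec.list_range.comp Primrec.fst) ?_
    refine (Primrec.option_getD.comp (Nat.Partrec.Code.primrec_evaln.comp (Primrec.pair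
      (Primrec.pair (Primrec.snd.comp Primrec.fst) ((Primrec.ofNat _).comp Primrec.snd))
      (Primrec.fst.comp Primrec.fst))) (Primrec.const 0)).to₂
  refine ⟨fun n => Denumerable.ofNat (Finset ℕ) (F (vals n (h n))), ?_, fun n => ?_, ?_⟩
  · refine ComputableIn.of_recursiveIn_encode ?_
    have hcode : Computable₂ fun n k => F (vals n k) := hF.comp hvals.to_comp
    refine (RecursiveIn.comp_computable₂ hcode (.of_computable Computable.id)
      hh.recursiveIn_encode).of_eq fun n => ?_
    simp
  · simpa [vals] using (hFspec (vals n (h n))).1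
  · intro f hf
    obtain ⟨e, t, ht, hstage⟩ := exists_computable_stage hf
    filter_upwards [hdom t ht, eventually_gt_atTop e] with n hn hen
    refine (hFspec _).2 _ (List.mem_map.2 ⟨e, List.mem_range.2 hen, ?_⟩)
    rw [Option.mem_def.1 (hstage n (h n) hn)]
    rfl

/-- The running sum of a computable function, a computable monotone bound for it. -/
theorem exists_computable_monotone_bound {f : ℕ → ℕ} (hf : Computable f) :
    ∃ g : ℕ → ℕ, Computable g ∧ Monotone g ∧ ∀ n, f n ≤ g n := by
  refine ⟨fun n => Nat.rec (f 0) (fun k s => s + f (k + 1)) n, ?_, ?_, ?_⟩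
  · refine Computable.nat_rec (h := fun _ p => p.2 + f (p.1 + 1)) Computable.id
      (Computable.const (f 0)) ?_
    exact Primrec.nat_add.to_comp.comp (Computable.snd.comp Computable.snd)
      (hf.comp (Computable.succ.comp (Computable.fst.comp Computable.snd)))
  · exact monotone_nat_of_le_succ fun n => Nat.le_add_right _ _
  · rintro (_ | n)
    · exact le_rfl
    · exact Nat.le_add_left _ _

theorem IsDGTraceIn.high {A D : Set ℕ} {g : ℕ →. ℕ} {σ : ℕ →. Finset ℕ}
    (hσ : IsDGTraceIn A D g σ) (htr : ∀ f : ℕ → ℕ, Computable f → DGTraces D σ f) :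
    High A := by
  obtain ⟨hinf, ⟨φ, hφ, hD⟩, -, -, -, hrec, hdom, -⟩ := hσ
  have hpair := RecursiveIn.pair hφ.recursiveIn_encode hrec.recursiveIn_encode
  obtain ⟨h, hh, hbound⟩ := hpair.exists_total_bound (hinf.mono fun n hn => by
    have h1 := (hD n).1 hn
    have h2 := hdom hn
    simp [PFun.Dom, Seq.seq] at h2 ⊢
    exact ⟨h1, h2⟩)
  refine ⟨h, ComputableIn.of_recursiveIn_encode hh, fun f hf => ?_⟩
  obtain ⟨b, hb, hmono, hfb⟩ := exists_computable_monotone_bound hf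
  obtain ⟨N, hN⟩ := eventually_atTop.1 (htr b hb)
  filter_upwards [eventually_ge_atTop N] with m hm
  obtain ⟨d, hd, v, hv, hvh⟩ := hbound m
  replace hv : v ∈ Nat.pair <$> Part.map Encodable.encode (φ d) <*>
      Part.map (@Encodable.encode (Finset ℕ) Primcodable.toEncodable) (σ d) := hv
  simp only [Seq.seq, Part.map_eq_map, Part.bind_map, Part.mem_bind_iff, Part.mem_map_iff] at hv
  obtain ⟨_, ⟨hφd, rfl⟩, _, ⟨S, hS, rfl⟩, rfl⟩ := hv
  have hmem : b d ∈ S := hN d (hm.trans hd) ((hD d).2 hφd) S hS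
  calc f m ≤ b m := hfb m
    _ ≤ b d := hmono hd
    _ ≤ _ := le_encode_of_mem_finset hmem
    _ ≤ _ := Nat.right_le_pair _ _
    _ ≤ h m := hvh

/-- `A` computes a trace tracing every total computable function
(equivalently, `A` is high) iff `A` computes a partial trace tracing every total
computable function. -/
theorem stmt8 (A : Set ℕ) :
    (∃ σ : ℕ → Finset ℕ, ComputableIn A σ ∧ (∀ n, (σ n).card ≤ n) ∧
        ∀ f : ℕ → ℕ, Computable f → Traces σ f) ↔
    (∃ (D : Set ℕ) (g : ℕ →. ℕ) (σ : ℕ →. Finset ℕ), IsDGTraceIn A D g σ ∧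
        ∀ f : ℕ → ℕ, Computable f → DGTraces D σ f) := by
  constructor
  · rintro ⟨σ, hσ, hcard, htr⟩
    refine ⟨Set.univ, (Nat.succ : ℕ → ℕ), σ, ⟨Set.infinite_univ, ?_, ?_, ?_, ?_, hσ, ?_, ?_⟩,
      fun f hf => ?_⟩
    · exact ⟨((fun _ => 0 : ℕ → ℕ) : ℕ →. ℕ), PartrecIn.of_partrec (Computable.const 0),
        fun a => by simp⟩
    · exact PartrecIn.of_partrec Computable.succ
    · simp
    · simp
    · simp
    · intro n _ S hS b hb
      simp only [PFun.coe_val, Part.mem_some_iff] at hS hb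
      subst hS hb
      exact Nat.lt_succ_of_le (hcard n)
    · filter_upwards [htr f hf] with n hn _ S hS
      simp only [PFun.coe_val, Part.mem_some_iff] at hS
      exact hS ▸ hn
  · rintro ⟨D, g, σ, hσ, htr⟩
    exact (hσ.high htr).exists_trace

end CichonAnalog
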